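/- Let a₁,a₂,a₃ be negative real numbers, R the subalgebra of ℝ[ν]⁵ defined above, K₋ the ideal of R generated by (0,0,0,0,ν³), and K₊ = {x ∈ R : x₅ = 0}. Then K₋ + K₊ = {x ∈ R : ν³ divides x₅}. In particular, every element of R whose fifth component is divisible by ν³ lies in K₋ + K₊, so (grading ℝ[ν] with ν in degree 2) every homogeneous element of R of degree at least 5 lies in K₋ + K₊. -/

import Mathlib

/-- The set `R ⊆ ℝ[ν]⁵` of 5-tuples of the form
`(q₁, q₁+a₂νq₂, q₁+(a₁+a₂)νq₂+a₁(a₁+a₂)ν²q₃, q₁+(a₂+a₃)νq₂+a₃(a₂+a₃)ν²q₄,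
  q₁+(a₁+a₂+a₃)νq₂+a₁(a₁+a₂+a₃)ν²q₃+a₃(a₁+a₂+a₃)ν²q₄+ν³q₅)`
with `q₁,…,q₅ ∈ ℝ[ν]`; here `a 0, a 1, a 2` play the roles of `a₁, a₂, a₃`. -/
noncomputable def Rcarrier (a : Fin 3 → ℝ) : Set (Fin 5 → Polynomial ℝ) :=
  {f | ∃ q : Fin 5 → Polynomial ℝ,
    f 0 = q 0 ∧
    f 1 = q 0 + Polynomial.C (a 1) * Polynomial.X * q 1 ∧
    f 2 = q 0 + Polynomial.C (a 0 + a 1) * Polynomial.X * q 1 +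
          Polynomial.C (a 0 * (a 0 + a 1)) * Polynomial.X ^ 2 * q 2 ∧
    f 3 = q 0 + Polynomial.C (a 1 + a 2) * Polynomial.X * q 1 +
          Polynomial.C (a 2 * (a 1 + a 2)) * Polynomial.X ^ 2 * q 3 ∧
    f 4 = q 0 + Polynomial.C (a 0 + a 1 + a 2) * Polynomial.X * q 1 +
          Polynomial.C (a 0 * (a 0 + a 1 + a 2)) * Polynomial.X ^ 2 * q 2 +
          Polynomial.C (a 2 * (a 0 + a 1 + a 2)) * Polynomial.X ^ 2 * q 3 +
          Polynomial.X ^ 3 * q 4}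

/-- Every subalgebra with carrier `Rcarrier a` contains the constant tuples `(g, g, g, g, g)`. -/
theorem const_mem_of_coe_eq_Rcarrier {a : Fin 3 → ℝ}
    {A : Subalgebra ℝ (Fin 5 → Polynomial ℝ)}
    (hA : (A : Set (Fin 5 → Polynomial ℝ)) = Rcarrier a) (g : Polynomial ℝ) :
    (fun _ => g) ∈ A := by
  rw [← SetLike.mem_coe, hA]
  exact ⟨![g, 0, 0, 0, 0], by simp⟩

/-- Let `R` be the subalgebra of `ℝ[ν]⁵` with carrier `Rcarrier a` (`a₁,a₂,a₃ < 0`),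
`K₋` the ideal of `R` generated by `u = (0,0,0,0,ν³)`, and `K₊` the ideal of `R`
consisting of all `x ∈ R` with `x₅ = 0`.  Then `K₋ + K₊ = {x ∈ R : ν³ ∣ x₅}`. -/
theorem Kminus_add_Kplus_description (a : Fin 3 → ℝ) (ha : ∀ i, a i < 0)
    (A : Subalgebra ℝ (Fin 5 → Polynomial ℝ))
    (hA : (A : Set (Fin 5 → Polynomial ℝ)) = Rcarrier a)
    (u : A) (hu : (u : Fin 5 → Polynomial ℝ) = ![0, 0, 0, 0, Polynomial.X ^ 3])
    (Kp : Ideal A) (hKp : ∀ x : A, x ∈ Kp ↔ (x : Fin 5 → Polynomial ℝ) 4 = 0) :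
    ((Ideal.span {u} + Kp : Ideal A) : Set A) =
      {x : A | (Polynomial.X : Polynomial ℝ) ^ 3 ∣ (x : Fin 5 → Polynomial ℝ) 4} := by
  have hu4 : (u : Fin 5 → Polynomial ℝ) 4 = Polynomial.X ^ 3 := by simp [hu]
  ext x
  rw [SetLike.mem_coe, Set.mem_ofPred_eq, Submodule.add_eq_sup]
  constructor
  · intro hx
    obtain ⟨y, hy, z, hz, rfl⟩ := Submodule.mem_sup.mp hx
    obtain ⟨c, rfl⟩ := Ideal.mem_span_singleton'.mp hy
    have hz4 := (hKp z).mp hz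
    refine ⟨(c : Fin 5 → Polynomial ℝ) 4, ?_⟩
    simp [hz4, hu4, mul_comm]
  · rintro ⟨g, hg⟩
    let d : A := ⟨fun _ => g, const_mem_of_coe_eq_Rcarrier hA g⟩
    refine Submodule.mem_sup.mpr ⟨d * u, Ideal.mem_span_singleton'.mpr ⟨d, rfl⟩,
      x - d * u, (hKp _).mpr ?_, add_sub_cancel _ _⟩
    simp [d, hg, hu4, mul_comm]
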